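/- (Proposition 3, IL failure.) Assume the dichotomy data model with query size k ≥ 2, ζ = P_π̄(M1) ∈ (0,1), and p*(1), p*(2) > 0, where the parameters k, ζ, p* and the set M1 are held fixed while |M2| varies, so that the joint distribution of the per-datum category counts and chosen categories does not depend on |M2|. For each dataset size n and each value of |M2|, let θ̂ minimize L_IL(π_θ) over θ ∈ ℝ². Then lim_{n→∞} P( lim_{|M2|→∞} P_{π_θ̂}(M1) = 0 ) = 1, where the inner limit is taken with the realized category/choice pattern of the dataset held fixed. -/

import Mathlib

open MeasureTheory Filter Finset Real

/-- Number of category-1 messages in a query, given the vector of category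
indicators of its `k` messages (`true` = category 1). -/
def catCount {k : ℕ} (v : Fin k → Bool) : ℕ := (Finset.univ.filter fun j => v j = true).card

/-- Probability that the chosen message is of category 1, given the category
pattern `v` of the query: the annotator's type is 1 with probability `p1`; the
choice is uniform on the messages of the annotator's category if present, and
uniform on the whole query otherwise. -/
noncomputable def chooseCat1Prob {k : ℕ} (p1 : ℝ) (v : Fin k → Bool) : ℝ :=
  if ∀ j, v j = true then 1 else if ∃ j, v j = true then p1 else 0

/-- Probability of a single datum pattern `(v, c)` in the dichotomy data model:
`v j` is the category indicator of the `j`-th message of the query (each message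
is of category 1 independently with probability `ζ = P_π̄(M1)`), and `c` is the
category of the chosen message.  This joint distribution of per-datum category
counts and chosen categories does not depend on `|M2|`. -/
noncomputable def datumProb {k : ℕ} (ζ p1 : ℝ) (d : (Fin k → Bool) × Bool) : ℝ :=
  (∏ j, if d.1 j then ζ else 1 - ζ) *
    (if d.2 then chooseCat1Prob p1 d.1 else 1 - chooseCat1Prob p1 d.1)

/-- Total probability `P_{π_θ}(M1)` assigned by the policy `π_θ` to the `m1`
category-1 messages, for the two-parameter policy architecture
`P_{π_θ}(x) = e^{θ_z}/(m1 e^{θ1} + m2 e^{θ2})` for `x` of category `z`. -/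
noncomputable def polM1 (m1 m2 : ℕ) (θ : ℝ × ℝ) : ℝ :=
  m1 * exp θ.1 / (m1 * exp θ.1 + m2 * exp θ.2)

/-- Total probability `P_{π_θ}(M2)` assigned by the policy `π_θ` to the `m2`
category-2 messages. -/
noncomputable def polM2 (m1 m2 : ℕ) (θ : ℝ × ℝ) : ℝ :=
  m2 * exp θ.2 / (m1 * exp θ.1 + m2 * exp θ.2)

/-- The inclusive-learning loss
`L_IL(π_θ) = -Σ_{(Y,y)∈D} ln( P_{π_θ}(y) / Σ_{y'∈Y} P_{π_θ}(y') ) + β KL(P_{π_θ} ‖ P_π̄)`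
written in terms of the dataset's category pattern, for the two-parameter policy
architecture with `|M1| = m1`, `|M2| = m2`, the base distribution being uniform
within each category with `P_π̄(M1) = ζ`. -/
noncomputable def ilLoss (m1 m2 : ℕ) (ζ β : ℝ) {k n : ℕ}
    (d : Fin n → (Fin k → Bool) × Bool) (θ : ℝ × ℝ) : ℝ :=
  -∑ i, log (exp (if (d i).2 then θ.1 else θ.2) /
      ((catCount (d i).1 : ℝ) * exp θ.1 + ((k : ℝ) - (catCount (d i).1 : ℝ)) * exp θ.2)) +
    β * (polM1 m1 m2 θ * log (polM1 m1 m2 θ / ζ) +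
      polM2 m1 m2 θ * log (polM2 m1 m2 θ / (1 - ζ)))

lemma chooseCat1Prob_mem_Icc {k : ℕ} {p1 : ℝ} (hp : p1 ∈ Set.Icc (0 : ℝ) 1) (v : Fin k → Bool) :
    chooseCat1Prob p1 v ∈ Set.Icc (0 : ℝ) 1 := by
  unfold chooseCat1Prob
  split_ifs <;> simp_all

lemma datumProb_nonneg {k : ℕ} {ζ p1 : ℝ} (hζ : ζ ∈ Set.Ioo (0 : ℝ) 1)
    (hp : p1 ∈ Set.Icc (0 : ℝ) 1) (d : (Fin k → Bool) × Bool) : 0 ≤ datumProb ζ p1 d := by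
  have h := chooseCat1Prob_mem_Icc hp d.1
  refine mul_nonneg (Finset.prod_nonneg fun j _ => ?_) ?_
  · split_ifs <;> linarith [hζ.1, hζ.2]
  · split_ifs <;> linarith [h.1, h.2]

lemma sum_datumProb (k : ℕ) (ζ p1 : ℝ) :
    ∑ d : (Fin k → Bool) × Bool, datumProb ζ p1 d = 1 := by
  have h : ∑ v : Fin k → Bool, ∏ j, (if v j then ζ else 1 - ζ) = 1 := by
    have := Finset.prod_univ_sum (fun _ : Fin k => (Finset.univ : Finset Bool))
      (fun _ b => if b then ζ else 1 - ζ)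
    rw [Fintype.piFinset_univ] at this
    rw [← this]
    simp
  rw [Fintype.sum_prod_type, ← h]
  refine Finset.sum_congr rfl fun v _ => ?_
  simp [datumProb]
  ring

/-- A datum of positive probability has its chosen category present in the query. -/
lemma present_of_datumProb_ne_zero {k : ℕ} (hk : 2 ≤ k) {ζ p1 : ℝ} {d : (Fin k → Bool) × Bool}
    (h : datumProb ζ p1 d ≠ 0) :
    (d.2 = true → 1 ≤ catCount d.1) ∧ (d.2 = false → catCount d.1 + 1 ≤ k) := by
  have hc := right_ne_zero_of_mul h
  constructor
  · intro hd
    by_contra hlt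
    have hzero : catCount d.1 = 0 := by omega
    have hno : ∀ j, d.1 j = false := by
      simpa [catCount, Finset.filter_eq_empty_iff] using hzero
    have : Nonempty (Fin k) := ⟨⟨0, by omega⟩⟩
    apply hc
    simp [hd, chooseCat1Prob, hno]
  · intro hd
    have hex : ¬ ∀ j, d.1 j = true := by
      intro hall
      apply hc
      simp [hd, chooseCat1Prob, hall]
    push Not at hex
    obtain ⟨j, hj⟩ := hex
    have : (Finset.univ.filter fun j => d.1 j = true) ⊂ Finset.univ :=
      Finset.filter_ssubset.2 ⟨j, Finset.mem_univ _, hj⟩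
    have := Finset.card_lt_card this
    simpa [catCount] using this

lemma datumLoss_nonneg {c k a b : ℝ} {z : Bool} (hc : 0 ≤ c) (hck : c ≤ k)
    (h1 : z = true → 1 ≤ c) (h2 : z = false → c + 1 ≤ k) :
    0 ≤ -log (exp (if z then a else b) / (c * exp a + (k - c) * exp b)) := by
  have ha := exp_pos a
  have hb := exp_pos b
  rw [neg_nonneg]
  have hle : exp (if z then a else b) ≤ c * exp a + (k - c) * exp b := by
    cases z
    · have := h2 rfl
      simp only [Bool.false_eq_true, if_false]
      nlinarith [mul_nonneg hc ha.le, mul_nonneg (show 0 ≤ k - c - 1 by linarith) hb.le]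
    · have := h1 rfl
      simp only [if_true]
      nlinarith [mul_nonneg (show 0 ≤ c - 1 by linarith) ha.le,
        mul_nonneg (show 0 ≤ k - c by linarith) hb.le]
  have hpos := (exp_pos _).trans_le hle
  exact log_nonpos (by positivity) ((div_le_one hpos).2 hle)

/-- Choosing category 2 from a query containing category 1 costs at least `θ1 - θ2`. -/
lemma sub_le_datumLoss {c k a b : ℝ} (h1 : 1 ≤ c) (hck : c ≤ k) :
    a - b ≤ -log (exp b / (c * exp a + (k - c) * exp b)) := by
  have ha := exp_pos a
  have hb := exp_pos b
  have hle : exp a ≤ c * exp a + (k - c) * exp b := by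
    nlinarith [mul_nonneg (show 0 ≤ c - 1 by linarith) ha.le,
      mul_nonneg (show 0 ≤ k - c by linarith) hb.le]
  rw [log_div hb.ne' (ha.trans_le hle).ne', log_exp]
  have := log_le_log ha hle
  rw [log_exp] at this
  linarith

lemma sub_le_mul_log_div {p q : ℝ} (hp : 0 < p) (hq : 0 < q) : p - q ≤ p * log (p / q) := by
  have h := one_sub_inv_le_log_of_pos (div_pos hp hq)
  have := mul_le_mul_of_nonneg_left h hp.le
  have e : p * (1 - (p / q)⁻¹) = p - q := by field_simp
  linarith

lemma mul_log_div_le {p q : ℝ} (hp : 0 < p) (hp1 : p ≤ 1) (hq : 0 < q) (hq1 : q ≤ 1) :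
    p * log (p / q) ≤ -log q := by
  rw [log_div hp.ne' hq.ne']
  nlinarith [log_nonpos hp.le hp1, log_nonpos hq.le hq1]

lemma polM1_pos {m1 m2 : ℕ} (h1 : 1 ≤ m1) (θ : ℝ × ℝ) : 0 < polM1 m1 m2 θ := by
  have : (0 : ℝ) < m1 := by exact_mod_cast h1
  unfold polM1
  positivity

lemma polM2_pos {m1 m2 : ℕ} (h2 : 1 ≤ m2) (θ : ℝ × ℝ) : 0 < polM2 m1 m2 θ := by
  have : (0 : ℝ) < m2 := by exact_mod_cast h2
  unfold polM2
  positivity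

lemma polM1_add_polM2 {m1 m2 : ℕ} (h1 : 1 ≤ m1) (θ : ℝ × ℝ) :
    polM1 m1 m2 θ + polM2 m1 m2 θ = 1 := by
  have : (0 : ℝ) < m1 := by exact_mod_cast h1
  unfold polM1 polM2
  rw [← add_div]
  exact div_self (by positivity)

lemma polM1_le {m1 m2 : ℕ} (h2 : 1 ≤ m2) {θ : ℝ × ℝ} {T : ℝ} (h : θ.1 - θ.2 ≤ T) :
    polM1 m1 m2 θ ≤ m1 * exp T / m2 := by
  have hm : (0 : ℝ) < m2 := by exact_mod_cast h2
  have hle : exp θ.1 ≤ exp T * exp θ.2 := by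
    rw [← exp_add]
    exact exp_le_exp.2 (by linarith)
  unfold polM1
  calc (m1 : ℝ) * exp θ.1 / (m1 * exp θ.1 + m2 * exp θ.2)
      ≤ m1 * (exp T * exp θ.2) / (m2 * exp θ.2) := by
        gcongr
        have : (0 : ℝ) ≤ m1 * exp θ.1 := by positivity
        linarith
    _ = m1 * exp T / m2 := by
        have := (exp_pos θ.2).ne'
        field_simp

/-- If every chosen category is present in its query, and category 2 is chosen at least once from
a query containing category 1, then the mass of `M1` under loss minimizers vanishes. -/
lemma tendsto_polM1_of_minimizer {k m1 n : ℕ} (hm1 : 1 ≤ m1) {ζ β : ℝ}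
    (hζ : ζ ∈ Set.Ioo (0 : ℝ) 1) (hβ : 0 < β) (d : Fin n → (Fin k → Bool) × Bool)
    (hd : ∀ i, ((d i).2 = true → 1 ≤ catCount (d i).1) ∧
      ((d i).2 = false → catCount (d i).1 + 1 ≤ k))
    (i₀ : Fin n) (hi₀ : (d i₀).2 = false) (hi₀' : 1 ≤ catCount (d i₀).1)
    (θ : ℕ → ℝ × ℝ)
    (hθ : ∀ m2, 1 ≤ m2 → ∀ θ', ilLoss m1 m2 ζ β d (θ m2) ≤ ilLoss m1 m2 ζ β d θ') :
    Tendsto (fun m2 => polM1 m1 m2 (θ m2)) atTop (nhds 0) := by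
  obtain ⟨hζ0, hζ1⟩ := hζ
  have hck : ∀ i, (catCount (d i).1 : ℝ) ≤ k := fun i => by
    have : catCount (d i).1 ≤ k := by
      simpa [catCount] using Finset.card_filter_le (Finset.univ : Finset (Fin k)) _
    exact_mod_cast this
  set L : ℝ × ℝ → ℝ := fun θ => ∑ i, -log (exp (if (d i).2 then θ.1 else θ.2) /
    ((catCount (d i).1 : ℝ) * exp θ.1 + ((k : ℝ) - (catCount (d i).1 : ℝ)) * exp θ.2)) with hL
  have hloss : ∀ m2 θ, ilLoss m1 m2 ζ β d θ = L θ +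
      β * (polM1 m1 m2 θ * log (polM1 m1 m2 θ / ζ) +
        polM2 m1 m2 θ * log (polM2 m1 m2 θ / (1 - ζ))) := fun m2 θ => by
    simp only [ilLoss, hL, Finset.sum_neg_distrib]
  have hLlow : ∀ θ, θ.1 - θ.2 ≤ L θ := fun θ => by
    have hterm := sub_le_datumLoss (a := θ.1) (b := θ.2)
      (show (1 : ℝ) ≤ catCount (d i₀).1 by exact_mod_cast hi₀') (hck i₀)
    refine hterm.trans ?_
    have := Finset.single_le_sum (f := fun i => -log (exp (if (d i).2 then θ.1 else θ.2) /
      ((catCount (d i).1 : ℝ) * exp θ.1 + ((k : ℝ) - (catCount (d i).1 : ℝ)) * exp θ.2)))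
      (fun i _ => datumLoss_nonneg (Nat.cast_nonneg _) (hck i)
        (fun h => by exact_mod_cast (hd i).1 h) (fun h => by exact_mod_cast (hd i).2 h))
      (Finset.mem_univ i₀)
    simp only [hi₀, Bool.false_eq_true, if_false] at this
    exact this
  set T : ℝ := L (0, 0) + β * (-log ζ + -log (1 - ζ)) with hT
  have hbound : ∀ m2, 1 ≤ m2 → (θ m2).1 - (θ m2).2 ≤ T := fun m2 hm2 => by
    have h := hθ m2 hm2 (0, 0)
    rw [hloss, hloss] at h
    have hsum := polM1_add_polM2 (m2 := m2) hm1 (θ m2)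
    have hsum' := polM1_add_polM2 (m2 := m2) hm1 (0, 0)
    have p := polM1_pos (m2 := m2) hm1 (0, 0)
    have q := polM2_pos (m1 := m1) hm2 (0, 0)
    have hlow := add_le_add (sub_le_mul_log_div (polM1_pos (m2 := m2) hm1 (θ m2)) hζ0)
      (sub_le_mul_log_div (polM2_pos (m1 := m1) hm2 (θ m2)) (sub_pos.2 hζ1))
    have hup := add_le_add (mul_log_div_le p (by linarith) hζ0 hζ1.le)
      (mul_log_div_le q (by linarith) (sub_pos.2 hζ1) (by linarith))
    have hlow' := mul_nonneg hβ.le (le_trans (by linarith) hlow)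
    have hup' := mul_le_mul_of_nonneg_left hup hβ.le
    linarith [hLlow (θ m2)]
  have hlim : Tendsto (fun m2 : ℕ => (m1 : ℝ) * exp T / m2) atTop (nhds 0) :=
    tendsto_const_div_atTop_nhds_zero_nat _
  refine squeeze_zero' (Eventually.of_forall fun m2 => (polM1_pos hm1 _).le) ?_ hlim
  filter_upwards [eventually_ge_atTop 1] with m2 hm2
  exact polM1_le hm2 (hbound m2 hm2)

/-- The probability that some datum has probability zero or that the datum `d₀` never occurs. -/
lemma measure_bad_le {k n : ℕ} {ζ p1 : ℝ} (hζ : ζ ∈ Set.Ioo (0 : ℝ) 1)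
    (hp : p1 ∈ Set.Icc (0 : ℝ) 1) {Ω : Type*} [MeasurableSpace Ω] (μ : Measure Ω)
    (D : Fin n → Ω → (Fin k → Bool) × Bool)
    (hiid : ∀ dd : Fin n → (Fin k → Bool) × Bool,
      μ {ω | ∀ i, D i ω = dd i} = ENNReal.ofReal (∏ i, datumProb ζ p1 (dd i)))
    (d₀ : (Fin k → Bool) × Bool) :
    μ {ω | ¬ ((∀ i, datumProb ζ p1 (D i ω) ≠ 0) ∧ ∃ i, D i ω = d₀)} ≤
      ENNReal.ofReal ((1 - datumProb ζ p1 d₀) ^ n) := by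
  classical
  have hnn := fun d => datumProb_nonneg (k := k) hζ hp d
  let A : Finset (Fin n → (Fin k → Bool) × Bool) :=
    Finset.univ.filter fun dd => ∃ i, datumProb ζ p1 (dd i) = 0
  let B : Finset (Fin n → (Fin k → Bool) × Bool) :=
    Fintype.piFinset fun _ => Finset.univ.erase d₀
  have hA : μ (⋃ dd ∈ A, {ω | ∀ i, D i ω = dd i}) = 0 := by
    refine (measure_biUnion_null_iff A.countable_toSet).2 fun dd hdd => ?_
    obtain ⟨i, hi⟩ := (Finset.mem_filter.1 hdd).2
    rw [hiid, Finset.prod_eq_zero (Finset.mem_univ i) hi, ENNReal.ofReal_zero]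
  have hB : μ (⋃ dd ∈ B, {ω | ∀ i, D i ω = dd i}) ≤
      ENNReal.ofReal ((1 - datumProb ζ p1 d₀) ^ n) := by
    refine (measure_biUnion_finset_le B _).trans_eq ?_
    simp_rw [hiid]
    rw [← ENNReal.ofReal_sum_of_nonneg fun dd _ => Finset.prod_nonneg fun i _ => hnn _]
    congr 1
    rw [← sum_datumProb k ζ p1, ← Finset.sum_erase_eq_sub (Finset.mem_univ d₀),
      ← Finset.prod_univ_sum]
    simp
  calc _ ≤ μ ((⋃ dd ∈ A, {ω | ∀ i, D i ω = dd i}) ∪ ⋃ dd ∈ B, {ω | ∀ i, D i ω = dd i}) := by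
        refine measure_mono fun ω hω => ?_
        rw [Set.mem_ofPred_eq, not_and_or] at hω
        push Not at hω
        refine hω.imp (fun h => ?_) fun h => ?_
        · exact Set.mem_biUnion (x := fun i => D i ω) (by simpa [A] using h) (fun i => rfl)
        · exact Set.mem_biUnion (x := fun i => D i ω) (by simpa [B] using h) (fun i => rfl)
    _ ≤ _ := (measure_union_le _ _).trans (by rw [hA, zero_add]; exact hB)

/-- **Proposition 3 (IL failure).**  Under the dichotomy data model with query
size `k ≥ 2`, `ζ = P_π̄(M1) ∈ (0,1)` and `p*(1), p*(2) > 0`, with `k`, `ζ`, `p*`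
and `M1` (of size `m1`) held fixed while `|M2| = m2` varies, let `θ̂ = θhat n m2`
minimize the inclusive-learning loss for each dataset size `n` and each value of
`m2`.  Then `lim_{n→∞} P( lim_{m2→∞} P_{π_θ̂}(M1) = 0 ) = 1`, the inner limit
being taken with the realized category/choice pattern of the dataset fixed. -/
theorem il_failure
    (k m1 : ℕ) (hk : 2 ≤ k) (hm1 : 1 ≤ m1)
    (ζ p1 p2 β : ℝ) (hζ : ζ ∈ Set.Ioo (0:ℝ) 1)
    (hp1 : 0 < p1) (hp2 : 0 < p2) (hp : p1 + p2 = 1) (hβ : 0 < β)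
    (Ω : Type*) [MeasurableSpace Ω] (μ : Measure Ω) [IsProbabilityMeasure μ]
    -- the dataset of size `n`: `n` i.i.d. pattern-level data (independent of `m2`)
    (D : (n : ℕ) → Fin n → Ω → (Fin k → Bool) × Bool)
    (hiid : ∀ n (dd : Fin n → (Fin k → Bool) × Bool),
      μ {ω | ∀ i, D n i ω = dd i} = ENNReal.ofReal (∏ i, datumProb ζ p1 (dd i)))
    -- for each dataset size `n` and each size `m2` of `M2`, `θ̂` minimizes `L_IL`
    (θhat : (n : ℕ) → (m2 : ℕ) → Ω → ℝ × ℝ)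
    (hθ : ∀ n m2, 1 ≤ m2 → ∀ ω θ',
      ilLoss m1 m2 ζ β (fun i => D n i ω) (θhat n m2 ω) ≤
        ilLoss m1 m2 ζ β (fun i => D n i ω) θ') :
    Tendsto
      (fun n => μ {ω | Tendsto (fun m2 => polM1 m1 m2 (θhat n m2 ω)) atTop (nhds 0)})
      atTop (nhds 1) := by
  have hp1' : p1 ∈ Set.Icc (0 : ℝ) 1 := ⟨hp1.le, by linarith⟩
  let j₀ : Fin k := ⟨0, by omega⟩
  let d₀ : (Fin k → Bool) × Bool := (fun j => decide (j = j₀), false)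
  have hcount : 1 ≤ catCount d₀.1 := Finset.card_pos.2 ⟨j₀, by simp [d₀]⟩
  have hd₀ : 0 < datumProb ζ p1 d₀ := by
    have hall : ¬ ∀ j : Fin k, j = j₀ := fun h => by
      have := congrArg Fin.val (h ⟨1, by omega⟩)
      simp [j₀] at this
    refine mul_pos (Finset.prod_pos fun j _ => ?_) ?_
    · split_ifs <;> linarith [hζ.1, hζ.2]
    · simp [d₀, chooseCat1Prob, hall]
      linarith
  have hle : datumProb ζ p1 d₀ ≤ 1 := by
    rw [← sum_datumProb k ζ p1]
    exact Finset.single_le_sum (fun d _ => datumProb_nonneg hζ hp1' d) (Finset.mem_univ d₀)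
  have hlow : ∀ n, 1 - ENNReal.ofReal ((1 - datumProb ζ p1 d₀) ^ n) ≤
      μ {ω | Tendsto (fun m2 => polM1 m1 m2 (θhat n m2 ω)) atTop (nhds 0)} := fun n => by
    have hbad := measure_bad_le hζ hp1' μ (D n) (hiid n) d₀
    rw [tsub_le_iff_right, ← measure_univ (μ := μ)]
    refine (measure_mono fun ω _ => ?_).trans
      ((measure_union_le _ {ω | ¬ ((∀ i, datumProb ζ p1 (D n i ω) ≠ 0) ∧
        ∃ i, D n i ω = d₀)}).trans (add_le_add_right hbad _))
    by_cases h : (∀ i, datumProb ζ p1 (D n i ω) ≠ 0) ∧ ∃ i, D n i ω = d₀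
    · obtain ⟨hpos, i, hi⟩ := h
      exact Or.inl (tendsto_polM1_of_minimizer hm1 hζ hβ (fun i => D n i ω)
        (fun i => present_of_datumProb_ne_zero hk (hpos i)) i (by simp [hi, d₀])
        (by simpa only [hi] using hcount) (fun m2 => θhat n m2 ω) fun m2 hm2 => hθ n m2 hm2 ω)
    · exact Or.inr h
  have hlim : Tendsto (fun n => 1 - ENNReal.ofReal ((1 - datumProb ζ p1 d₀) ^ n))
      atTop (nhds 1) := by
    have h := ENNReal.tendsto_ofReal
      (tendsto_pow_atTop_nhds_zero_of_lt_one (sub_nonneg.2 hle) (sub_lt_self 1 hd₀))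
    simpa using ENNReal.Tendsto.sub tendsto_const_nhds h (Or.inl ENNReal.one_ne_top)
  exact tendsto_of_tendsto_of_tendsto_of_le_of_le hlim tendsto_const_nhds hlow
    fun n => prob_le_one
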